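/- arXiv:1905.13282 — 2 statements merged into one kernel-verified Lean document; each statement's English description precedes it below -/
import Mathlib

section
/- Let K ⊂ ℂ be a totally imaginary number field of degree [K:ℚ] = 2d ≥ 4, with Galois closure K^gal ⊂ ℂ, Galois group G = Gal(K^gal/ℚ) acting on the set X = Hom(K,ℂ) of embeddings, and τ ∈ G the restriction of complex conjugation. Assume condition (*) holds: for any x ≠ y in X there exist z ∈ X and σ ∈ G with x = σz and y = στz (this holds in particular if G acts 2-transitively on X). Then for every linear form l ∈ K[x₁,x₂,x₃] with sufficiently general coefficients, the norm form f = N_{K/ℚ}(l) is not ℚ-sos, i.e., f is not a sum of squares of polynomials with rational coefficients. -/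
/-- Finitely many nonzero linear forms over an infinite field have a common non-zero. -/
theorem Module.Dual.exists_forall_ne_zero {k V ι : Type*} [Field k] [Infinite k]
    [AddCommGroup V] [Module k V] [Finite ι] (φ : ι → Module.Dual k V) (hφ : ∀ i, φ i ≠ 0) :
    ∃ v, ∀ i, φ i v ≠ 0 := by
  by_contra! h
  obtain ⟨i, hi⟩ := Subspace.exists_eq_top_of_iUnion_eq_univ (p := fun i => LinearMap.ker (φ i))
    (Set.eq_univ_of_forall fun v => by simpa using h v)
  exact hφ i (LinearMap.ker_eq_top.mp hi)

/-- A function that is polynomial of degree at most `d` on every affine line and vanishes on more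
than `d` distinct hyperplanes through the origin is zero. -/
theorem eq_zero_of_forall_ker_eq_zero {k V ι : Type*} [Field k] [Infinite k]
    [AddCommGroup V] [Module k V] [Finite ι] [Nontrivial ι] {d : ℕ} (hd : d < Nat.card ι)
    (L : ι → Module.Dual k V) (hL : ∀ x y, x ≠ y → ∃ v, L x v = 0 ∧ L y v ≠ 0) (q : V → k)
    (hq : ∀ w u, ∃ P : Polynomial k, P.natDegree ≤ d ∧ ∀ t, P.eval t = q (w + t • u))
    (h0 : ∀ x v, L x v = 0 → q v = 0) (v : V) : q v = 0 := by
  have := Fintype.ofFinite ι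
  obtain ⟨u, hu⟩ := Module.Dual.exists_forall_ne_zero L fun y hy => by
    obtain ⟨x, hx⟩ := exists_ne y
    obtain ⟨v, -, hv⟩ := hL x y hx
    simp [hy] at hv
  let M : {z : ι × ι // z.1 ≠ z.2} → Module.Dual k V :=
    fun z => L z.1.2 u • L z.1.1 - L z.1.1 u • L z.1.2
  obtain ⟨w₀, hw₀⟩ := Module.Dual.exists_forall_ne_zero M fun ⟨⟨x, y⟩, hxy⟩ hM => by
    obtain ⟨v, hx, hy⟩ := hL x y hxy
    have := LinearMap.congr_fun hM v
    simp [M, hx, hy, hu] at this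
  have hgood : ∀ w, (∀ z, M z w ≠ 0) → q w = 0 := by
    intro w hw
    obtain ⟨P, hP, hPq⟩ := hq w u
    have hinj : Function.Injective fun x => -(L x w / L x u) := by
      intro x y hxy
      by_contra hne
      apply hw ⟨(x, y), hne⟩
      have := neg_injective hxy
      rw [div_eq_div_iff (hu x) (hu y)] at this
      simp only [M, LinearMap.sub_apply, LinearMap.smul_apply, smul_eq_mul]
      linear_combination this
    have hP0 : P = 0 := by
      refine Polynomial.eq_zero_of_natDegree_lt_card_of_eval_eq_zero P hinj (fun x => ?_)
        (hP.trans_lt (by simpa [Nat.card_eq_fintype_card] using hd))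
      rw [hPq]
      apply h0 x
      have := hu x
      simp only [map_add, map_smul, smul_eq_mul]
      field_simp
      ring
    simpa [hP0] using (hPq 0).symm
  obtain ⟨P, -, hPq⟩ := hq v w₀
  have hP0 : P = 0 := by
    refine Polynomial.eq_zero_of_infinite_isRoot P (Set.Infinite.mono (s :=
      (Set.range fun z => -(M z v / M z w₀))ᶜ) (fun t ht => ?_)
      (Set.finite_range _).infinite_compl)
    rw [Set.mem_ofPred_eq, Polynomial.IsRoot, hPq]
    refine hgood _ fun z hz => ht ⟨z, ?_⟩
    have := hw₀ z
    simp only [map_add, map_smul, smul_eq_mul] at hz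
    field_simp
    linear_combination -hz
  simpa [hP0] using (hPq 0).symm

namespace MvPolynomial

/-- The restriction of a polynomial to an affine line, as a univariate polynomial. -/
theorem exists_polynomial_eval_line {k σ : Type*} [CommRing k] (p : MvPolynomial σ k)
    (w u : σ → k) : ∃ P : Polynomial k, P.natDegree ≤ p.totalDegree ∧
      ∀ t, P.eval t = eval (w + t • u) p := by
  refine ⟨aeval (fun i => Polynomial.C (u i) * Polynomial.X + Polynomial.C (w i)) p, ?_, ?_⟩
  · simpa using aeval_natDegree_le p le_rfl
      (fun i => Polynomial.C (u i) * Polynomial.X + Polynomial.C (w i))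
      (n := 1) fun i => Polynomial.natDegree_linear_le
  · intro t
    rw [← Polynomial.coe_evalRingHom, aeval_def, hom_eval₂, eval, coe_eval₂Hom]
    congr 1
    · ext; simp
    · ext i; simp; ring

/-- In a sum of squares over an ordered field no cancellation of leading terms occurs. -/
theorem two_mul_totalDegree_le_of_eq_sum_sq {k σ ι : Type*} [Field k] [LinearOrder k]
    [IsStrictOrderedRing k] [LinearOrder σ] [WellFoundedGT σ] [Fintype ι]
    {f : MvPolynomial σ k} {p : ι → MvPolynomial σ k} (h : f = ∑ i, p i ^ 2) (i : ι) :
    2 * (p i).totalDegree ≤ f.totalDegree := by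
  let m : MonomialOrder σ := MonomialOrder.degLex
  obtain ⟨j, -, hj⟩ := Finset.exists_max_image Finset.univ
    (fun i => m.toSyn (m.degree (p i))) ⟨i, Finset.mem_univ i⟩
  have hij : (p i).totalDegree ≤ (p j).totalDegree :=
    degLex_totalDegree_monotone (hj i (Finset.mem_univ i))
  rcases eq_or_ne (p j) 0 with h0 | h0
  · rw [h0, totalDegree_zero] at hij
    simp [Nat.le_zero.mp hij]
  have hc : coeff (m.degree (p j) + m.degree (p j)) f ≠ 0 := by
    rw [h, coeff_sum]
    simp_rw [sq]
    rw [Finset.sum_congr rfl fun i hi => m.coeff_mul_of_add_of_degree_le (hj i hi) (hj i hi)]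
    refine (Finset.sum_pos' (fun i _ => mul_self_nonneg _) ⟨j, Finset.mem_univ j, ?_⟩).ne'
    exact mul_self_pos.mpr (m.coeff_degree_ne_zero_iff.mpr h0)
  have := le_totalDegree (mem_support_iff.mpr hc)
  have hdeg : (m.degree (p j)).degree = (p j).totalDegree := degree_degLexDegree
  change Finsupp.degree _ ≤ _ at this
  rw [map_add, hdeg] at this
  omega

/-- A linear form, as a linear functional. -/
noncomputable def linearFormDual {k σ : Type*} [Field k] [Fintype σ] (l : MvPolynomial σ k) :
    Module.Dual k (σ → k) :=
  ∑ i, coeff (Finsupp.single i 1) l • LinearMap.proj i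

theorem IsHomogeneous.linearFormDual_apply {k σ : Type*} [Field k] [Fintype σ]
    {l : MvPolynomial σ k} (hl : l.IsHomogeneous 1) (v : σ → k) :
    linearFormDual l v = eval v l := by
  classical
  have h : l ∈ Submodule.span k (Set.range (X : σ → MvPolynomial σ k)) := by
    rwa [← homogeneousSubmodule_one_eq_span_X]
  clear hl
  induction h using Submodule.span_induction with
  | mem x hx =>
    obtain ⟨i, rfl⟩ := hx
    simp [linearFormDual, coeff_X, Finsupp.single_left_inj]
  | zero => simp [linearFormDual]
  | add x y hx hy ihx ihy =>
    rw [map_add, ← ihx, ← ihy]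
    simp [linearFormDual, add_mul, Finset.sum_add_distrib]
  | smul a x hx ih =>
    rw [smul_eval, ← ih]
    simp [linearFormDual, mul_assoc, Finset.mul_sum]

/-- A polynomial with rational coefficients is compatible with ring automorphisms. -/
theorem eval_comp_map_rat {σ : Type*} (g : ℂ →+* ℂ) (v : σ → ℂ) (p : MvPolynomial σ ℚ) :
    eval (g ∘ v) (map (algebraMap ℚ ℂ) p) = g (eval v (map (algebraMap ℚ ℂ) p)) := by
  rw [eval_map, eval_map, hom_eval₂, Subsingleton.elim (g.comp (algebraMap ℚ ℂ))]
  rfl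

/-- If a rational sum of squares vanishes at a real point, so does every summand. -/
theorem eval_eq_zero_of_sum_sq {σ ι : Type*} [Fintype ι] {p : ι → MvPolynomial σ ℚ} {r : σ → ℝ}
    (h : eval (fun i => (r i : ℂ)) (map (algebraMap ℚ ℂ) (∑ i, p i ^ 2)) = 0) (i : ι) :
    eval (fun i => (r i : ℂ)) (map (algebraMap ℚ ℂ) (p i)) = 0 := by
  have hr : ∀ q : MvPolynomial σ ℚ, eval (fun i => (r i : ℂ)) (map (algebraMap ℚ ℂ) q) =
      ((eval r (map (algebraMap ℚ ℝ) q) : ℝ) : ℂ) := by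
    intro q
    rw [eval_map, eval_map, ← Complex.ofRealHom_eq_coe, hom_eval₂,
      Subsingleton.elim (Complex.ofRealHom.comp _)]
    rfl
  rw [hr, Complex.ofReal_eq_zero] at *
  simp only [map_sum, map_pow] at h
  exact pow_eq_zero_iff two_ne_zero |>.mp <|
    (Finset.sum_eq_zero_iff_of_nonneg fun _ _ => sq_nonneg _).mp h i (Finset.mem_univ i)

end MvPolynomial

open MvPolynomial in
/-- A polynomial of degree at most `d` vanishes as soon as it vanishes at all pairwise
intersections of more than `d + 1` general hyperplanes in three-dimensional space. -/
theorem MvPolynomial.eq_zero_of_forall_inter_eq_zero {k ι : Type*} [Field k] [Infinite k]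
    [Finite ι] {d : ℕ} (hd : d + 1 < Nat.card ι) (hι : 2 < Nat.card ι)
    (L : ι → Module.Dual k (Fin 3 → k))
    (hgen : ∀ x y z, x ≠ y → x ≠ z → y ≠ z → ∀ v, v ≠ 0 → ¬ (L x v = 0 ∧ L y v = 0 ∧ L z v = 0))
    {p : MvPolynomial (Fin 3) k} (hp : p.totalDegree ≤ d)
    (h : ∀ x y, x ≠ y → ∀ v, L x v = 0 → L y v = 0 → eval v p = 0) : p = 0 := by
  classical
  have := Fintype.ofFinite ι
  rw [Nat.card_eq_fintype_card] at hι
  have hinter : ∀ x y, ∃ v, v ≠ 0 ∧ L x v = 0 ∧ L y v = 0 := by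
    intro x y
    obtain ⟨v, hv, hv0⟩ := Submodule.exists_mem_ne_zero_of_ne_bot
      (LinearMap.ker_ne_bot_of_finrank_lt (f := (L x).prod (L y)) (by simp))
    exact ⟨v, hv0, by simpa using hv⟩
  have hthird : ∀ x y : ι, ∃ z, z ≠ x ∧ z ≠ y := by
    intro x y
    obtain ⟨z, hz⟩ := Finset.exists_mem_notMem_of_card_lt_card (s := {x, y}) (t := Finset.univ)
      (Finset.card_le_two.trans_lt hι)
    exact ⟨z, by simpa using hz⟩
  have : Nontrivial ι := Fintype.one_lt_card_iff_nontrivial.mp (by omega)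
  have hplane : ∀ x v, L x v = 0 → eval v p = 0 := by
    intro x v hv
    have hcard : Nat.card {y // y ≠ x} + 1 = Nat.card ι := by
      simp only [Nat.card_eq_fintype_card, Fintype.card_subtype_compl, Fintype.card_unique]
      omega
    have : Nontrivial {y // y ≠ x} := Finite.one_lt_card_iff_nontrivial.mp (by
      rw [← Nat.card_eq_fintype_card] at hι; omega)
    refine eq_zero_of_forall_ker_eq_zero (d := d) (V := LinearMap.ker (L x))
      (ι := {y // y ≠ x}) (by omega) (fun y => (L y).comp (Submodule.subtype _)) ?_
      (fun w => eval (w : Fin 3 → k) p) ?_ ?_ ⟨v, hv⟩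
    · rintro ⟨y, hy⟩ ⟨z, hz⟩ hyz
      obtain ⟨w, hw, hwx, hwy⟩ := hinter x y
      exact ⟨⟨w, hwx⟩, hwy, fun hwz =>
        hgen x y z hy.symm hz.symm (by simpa using hyz) w hw ⟨hwx, hwy, hwz⟩⟩
    · intro w u
      obtain ⟨P, hP, hPt⟩ := exists_polynomial_eval_line p w u
      exact ⟨P, hP.trans hp, by simpa using hPt⟩
    · rintro ⟨y, hy⟩ ⟨w, hw⟩ hwy
      exact h x y hy.symm w hw hwy
  refine MvPolynomial.funext fun v => ?_
  rw [map_zero]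
  refine eq_zero_of_forall_ker_eq_zero (d := d) (by omega) L ?_ (fun w => eval w p) ?_ hplane v
  · intro x y hxy
    obtain ⟨z, hzx, hzy⟩ := hthird x y
    obtain ⟨w, hw, hwx, hwz⟩ := hinter x z
    exact ⟨w, hwx, fun hwy => hgen x y z hxy hzx.symm hzy.symm w hw ⟨hwx, hwy, hwz⟩⟩
  · intro w u
    obtain ⟨P, hP, hPt⟩ := exists_polynomial_eval_line p w u
    exact ⟨P, hP.trans hp, hPt⟩

open MvPolynomial

/-- Let `K ⊂ ℂ` be a totally imaginary number field of degree `2d ≥ 4`. The Galois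
group `G = Gal(K^gal/ℚ)` acts on the set `X = Hom(K,ℂ)` of embeddings; this action
is encoded here by post-composition with ring automorphisms of `ℂ` (every
automorphism of `ℂ` restricts to an automorphism of the Galois closure `K^gal`,
and conversely every element of `Gal(K^gal/ℚ)` extends to an automorphism of `ℂ`,
so both induce the same permutations of `X`). Complex conjugation `τ` acts by
`σ ↦ conj ∘ σ`. If condition `(*)` holds — every pair `x ≠ y` in `X` is of the
form `x = σ • z`, `y = σ • (τ • z)` (which holds in particular when the action is
2-transitive) — then for every linear form `l ∈ K[x₁,x₂,x₃]` with sufficiently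
general coefficients, the norm form `f = N_{K/ℚ}(l) = ∏_{σ ∈ X} σ(l)` is not a
sum of squares of polynomials with rational coefficients. -/
theorem statement0 (d : ℕ) (hd : 2 ≤ d) (K : IntermediateField ℚ ℂ)
    (hdeg : Module.finrank ℚ K = 2 * d)
    (himag : IsEmpty (K →+* ℝ))
    (hstar : ∀ x y : K →+* ℂ, x ≠ y →
      ∃ (z : K →+* ℂ) (g : ℂ ≃+* ℂ),
        x = (g : ℂ →+* ℂ).comp z ∧
        y = (g : ℂ →+* ℂ).comp ((starRingEnd ℂ).comp z))
    (l : MvPolynomial (Fin 3) K) (hl : l.IsHomogeneous 1)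
    (hgen : ∀ σ₁ σ₂ σ₃ : K →+* ℂ, σ₁ ≠ σ₂ → σ₁ ≠ σ₃ → σ₂ ≠ σ₃ →
      ∀ v : Fin 3 → ℂ, v ≠ 0 →
        ¬ (eval v (map σ₁ l) = 0 ∧ eval v (map σ₂ l) = 0 ∧ eval v (map σ₃ l) = 0))
    (f : MvPolynomial (Fin 3) ℚ)
    (hf : map (algebraMap ℚ ℂ) f = ∏ᶠ σ : K →+* ℂ, map σ l) :
    ¬ ∃ (r : ℕ) (p : Fin r → MvPolynomial (Fin 3) ℚ), f = ∑ i, p i ^ 2 := by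
  rintro ⟨r, p, rfl⟩
  have : FiniteDimensional ℚ K := Module.finite_of_finrank_pos (by omega)
  have : NumberField K := ⟨⟩
  rw [finprod_eq_prod_of_fintype] at hf
  have hcard : Nat.card (K →+* ℂ) = 2 * d := by
    rw [Nat.card_eq_fintype_card, NumberField.Embeddings.card, hdeg]
  let L : (K →+* ℂ) → Module.Dual ℂ (Fin 3 → ℂ) := fun σ => linearFormDual (map σ l)
  have hL : ∀ σ v, L σ v = eval v (map σ l) := fun σ v => (hl.map σ).linearFormDual_apply v
  have hLg : ∀ (g : ℂ →+* ℂ) z v, L (g.comp z) (g ∘ v) = g (L z v) := by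
    intro g z v
    rw [hL, hL, eval_map, eval_map, hom_eval₂]
    rfl
  have hgenL : ∀ x y z, x ≠ y → x ≠ z → y ≠ z → ∀ v, v ≠ 0 →
      ¬ (L x v = 0 ∧ L y v = 0 ∧ L z v = 0) := by simpa only [hL] using hgen
  have hinj : Function.Injective (map (σ := Fin 3) (algebraMap ℚ ℂ)) :=
    map_injective _ (algebraMap ℚ ℂ).injective
  have hdegf : (∑ i, p i ^ 2).totalDegree ≤ 2 * d := by
    have hhom := IsHomogeneous.prod Finset.univ (fun σ : K →+* ℂ => map σ l) (fun _ => 1)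
      fun σ _ => hl.map σ
    rw [← hf] at hhom
    simpa [← Nat.card_eq_fintype_card, hcard] using
      (hhom.of_map (algebraMap ℚ ℂ).injective).totalDegree_le
  -- The summands vanish on the intersection of a plane with its complex conjugate.
  have hconj : ∀ z i v, L z v = 0 → L ((starRingEnd ℂ).comp z) v = 0 →
      eval v (map (algebraMap ℚ ℂ) (p i)) = 0 := by
    intro z i v hz hz'
    have hz'' : L z (starRingEnd ℂ ∘ v) = 0 := by
      apply (starRingEnd ℂ).injective
      rw [← hLg, map_zero, ← hz']
      congr 1
      ext; simp
    have hreal : ∀ t : Fin 3 → ℝ, L z (fun j => (t j : ℂ)) = 0 →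
        eval (fun j => (t j : ℂ)) (map (algebraMap ℚ ℂ) (p i)) = 0 := by
      intro t ht
      refine eval_eq_zero_of_sum_sq ?_ i
      rw [hf, map_prod]
      exact Finset.prod_eq_zero (Finset.mem_univ z) (by rw [← hL, ht])
    have hre : L z (fun j => ((v j).re : ℂ)) = 0 := by
      have : (fun j => ((v j).re : ℂ)) = (2⁻¹ : ℂ) • (v + starRingEnd ℂ ∘ v) := by
        ext j
        simp [Complex.re_eq_add_conj]
        ring
      rw [this, map_smul, map_add, hz, hz'', add_zero, smul_zero]
    have him : L z (fun j => ((v j).im : ℂ)) = 0 := by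
      have : (fun j => ((v j).im : ℂ)) = (2 * Complex.I : ℂ)⁻¹ • (v - starRingEnd ℂ ∘ v) := by
        ext j
        simp only [Complex.im_eq_sub_conj, Pi.smul_apply, Pi.sub_apply, Function.comp_apply,
          smul_eq_mul]
        ring
      rw [this, map_smul, map_sub, hz, hz'', sub_zero, smul_zero]
    obtain ⟨P, -, hP⟩ := exists_polynomial_eval_line (map (algebraMap ℚ ℂ) (p i))
      (fun j => ((v j).re : ℂ)) (fun j => ((v j).im : ℂ))
    have hP0 : P = 0 := by
      refine Polynomial.eq_zero_of_infinite_isRoot P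
        ((Set.infinite_range_of_injective Complex.ofReal_injective).mono ?_)
      rintro _ ⟨t, rfl⟩
      rw [Set.mem_ofPred_eq, Polynomial.IsRoot, hP]
      have hcast : (fun j => ((v j).re : ℂ)) + (t : ℂ) • (fun j => ((v j).im : ℂ)) =
          fun j => (((v j).re + t * (v j).im : ℝ) : ℂ) := by
        ext j
        simp
      rw [hcast]
      apply hreal
      rw [← hcast, map_add, map_smul, hre, him, smul_zero, add_zero]
    have hI := hP Complex.I
    rw [hP0, Polynomial.eval_zero] at hI
    rw [hI]
    congr 2
    ext j
    simp [mul_comm Complex.I, Complex.re_add_im]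
  have hp0 : ∀ i, map (algebraMap ℚ ℂ) (p i) = 0 := by
    intro i
    refine eq_zero_of_forall_inter_eq_zero (d := d) (by omega) (by omega) L hgenL ?_ ?_
    · have := two_mul_totalDegree_le_of_eq_sum_sq rfl i (p := p)
      have : (map (algebraMap ℚ ℂ) (p i)).totalDegree ≤ (p i).totalDegree :=
        Finset.sup_mono (support_map_subset _ _)
      omega
    · intro x y hxy v hx hy
      obtain ⟨z, g, rfl, rfl⟩ := hstar x y hxy
      obtain ⟨w, rfl⟩ : ∃ w, v = (g : ℂ →+* ℂ) ∘ w := ⟨g.symm ∘ v, by ext; simp⟩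
      rw [hLg, map_eq_zero] at hx hy
      rw [eval_comp_map_rat, hconj z i w hx hy, map_zero]
  have hprod : ∏ σ : K →+* ℂ, map σ l = 0 := by
    rw [← hf]
    simp [hp0]
  obtain ⟨σ, -, hσ⟩ := Finset.prod_eq_zero_iff.mp hprod
  have hl0 : l = 0 := map_injective σ σ.injective (by rw [hσ, map_zero])
  obtain ⟨x, y, z, hxy, hxz, hyz⟩ := Fintype.two_lt_card_iff.mp
    (show 2 < Fintype.card (K →+* ℂ) by rw [← Nat.card_eq_fintype_card]; omega)
  exact hgen x y z hxy hxz hyz 1 one_ne_zero (by simp [hl0])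
end

section
/- Let K ⊂ ℂ be a totally imaginary number field of degree [K:ℚ] = 2d ≥ 4, with Galois closure K^gal ⊂ ℂ, Galois group G = Gal(K^gal/ℚ) acting on X = Hom(K,ℂ), and τ ∈ G the restriction of complex conjugation. Assume condition (**) holds: the characteristic number c(G,X,τ) = |{gτg⁻¹·x : g ∈ G}| (for any x ∈ X) satisfies c(G,X,τ) > d. Then for every linear form l ∈ K[x₁,x₂,x₃] with sufficiently general coefficients, the norm form f = N_{K/ℚ}(l) is not ℚ-sos, i.e., f is not a sum of squares of polynomials with rational coefficients. -/
open MvPolynomial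

theorem totalDegree_le_of_sum_sq {r d : ℕ} (p : Fin r → MvPolynomial (Fin 3) ℚ)
    (h : (∑ i, p i ^ 2).totalDegree ≤ 2 * d) (i : Fin r) : (p i).totalDegree ≤ d := by
  obtain ⟨j, -, hj⟩ := Finset.univ.exists_max_image
    (fun k => MonomialOrder.degLex.toSyn (MonomialOrder.degLex.degree (p k))) ⟨i, Finset.mem_univ i⟩
  set m := MonomialOrder.degLex.degree (p j) with hm
  refine (degLex_totalDegree_monotone (hj i (Finset.mem_univ i))).trans ?_
  by_cases hpj : p j = 0
  · simp [hpj]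
  have hc : (∑ k, p k ^ 2).coeff (m + m) = ∑ k, (p k).coeff m ^ 2 := by
    rw [coeff_sum]
    refine Finset.sum_congr rfl fun k hk => ?_
    rw [sq, sq, MonomialOrder.degLex.coeff_mul_of_add_of_degree_le (hj k hk) (hj k hk)]
  have hpos : (∑ k, p k ^ 2).coeff (m + m) ≠ 0 := by
    rw [hc]
    refine (Finset.sum_pos' (fun k _ => sq_nonneg _) ⟨j, Finset.mem_univ j, ?_⟩).ne'
    exact sq_pos_of_ne_zero (MonomialOrder.degLex.coeff_degree_ne_zero_iff.mpr hpj)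
  have h2 := (le_totalDegree (mem_support_iff.mpr hpos)).trans h
  change (m + m).degree ≤ _ at h2
  rw [map_add] at h2
  rw [← degree_degLexDegree, ← hm]
  omega

theorem eval_aeval_line {ι R : Type*} [CommRing R] (a b : ι → R) (p : MvPolynomial ι R) (t : R) :
    (aeval (fun i => Polynomial.C (a i) + Polynomial.C (b i) * Polynomial.X) p).eval t =
      eval (a + t • b) p := by
  induction p using MvPolynomial.induction_on with
  | C r => simp
  | add p q hp hq => simp [hp, hq]
  | mul_X p i hp => simp [hp, mul_comm t]

theorem eval_line_eq_zero_of_real {ι : Type*} {p : MvPolynomial ι ℂ} {a b : ι → ℂ}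
    (h : ∀ t : ℝ, eval (a + (t : ℂ) • b) p = 0) (z : ℂ) : eval (a + z • b) p = 0 := by
  rw [← eval_aeval_line, Polynomial.eq_zero_of_infinite_isRoot (aeval _ p), Polynomial.eval_zero]
  refine (Set.infinite_range_of_injective Complex.ofReal_injective).mono ?_
  rintro _ ⟨t, rfl⟩
  exact (eval_aeval_line a b p t).trans (h t)

theorem map_eval_map {ι R S T : Type*} [CommRing R] [CommRing S] [CommRing T] (g : S →+* T)
    (σ : R →+* S) (v : ι → S) (q : MvPolynomial ι R) :
    g (eval v (map σ q)) = eval (g ∘ v) (map (g.comp σ) q) := by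
  rw [eval_map, eval_map, eval₂_comp_left]

theorem exists_ne_zero_of_two (L M : (Fin 3 → ℂ) →ₗ[ℂ] ℂ) : ∃ v ≠ 0, L v = 0 ∧ M v = 0 := by
  obtain ⟨v, hv, h0⟩ := (Submodule.ne_bot_iff _).mp
    (LinearMap.ker_ne_bot_of_finrank_lt (f := L.prod M) (by simp))
  exact ⟨v, h0, by simpa using hv⟩

theorem exists_linearMap_eq_eval {ι R : Type*} [CommRing R] {l : MvPolynomial ι R}
    (hl : l.IsHomogeneous 1) : ∃ L : (ι → R) →ₗ[R] R, ∀ v, L v = eval v l := by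
  have h : l ∈ homogeneousSubmodule ι R 1 := hl
  rw [homogeneousSubmodule_one_eq_span_X] at h
  clear hl
  induction h using Submodule.span_induction with
  | mem x hx => obtain ⟨i, rfl⟩ := hx; exact ⟨LinearMap.proj i, by simp⟩
  | zero => exact ⟨0, by simp⟩
  | add x y _ _ hx hy =>
    obtain ⟨L, hL⟩ := hx
    obtain ⟨M, hM⟩ := hy
    exact ⟨L + M, by simp [hL, hM]⟩
  | smul c x _ hx =>
    obtain ⟨L, hL⟩ := hx
    exact ⟨c • L, by simp [hL, smul_eval]⟩

theorem exists_forall_add_mul_ne_zero {ι F : Type*} [Field F] [Infinite F] (s : Finset ι)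
    (α β : ι → F) (h : ∀ i ∈ s, α i ≠ 0 ∨ β i ≠ 0) : ∃ t, ∀ i ∈ s, α i + t * β i ≠ 0 := by
  classical
  obtain ⟨t, ht⟩ := Infinite.exists_notMem_finset (s.image fun i => -α i / β i)
  refine ⟨t, fun i hi h0 => ?_⟩
  by_cases hb : β i = 0
  · rcases h i hi with h | h
    · exact h (by simpa [hb] using h0)
    · exact h hb
  · refine ht (Finset.mem_image.mpr ⟨i, hi, ?_⟩)
    rw [div_eq_iff hb]
    linear_combination -h0

/-- If the polynomials `P i` of degree at most `d` vanish at more than `d` intersection points of one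
line `L x = 0` with the other lines of an arrangement in general position, then `∑ i, P i ^ 2`
is not the product of the arrangement. -/
theorem sum_sq_ne_prod {ι : Type*} [Fintype ι] {r d : ℕ} (hd : 2 ≤ d)
    (L : ι → (Fin 3 → ℂ) →ₗ[ℂ] ℂ)
    (hgen : ∀ x y z, x ≠ y → x ≠ z → y ≠ z → ∀ v, L x v = 0 → L y v = 0 → L z v = 0 → v = 0)
    (x : ι) (S : Finset ι) (hx : x ∉ S) (hcard : d < S.card)
    (P : Fin r → MvPolynomial (Fin 3) ℂ) (hP : ∀ i, (P i).totalDegree ≤ d)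
    (hS : ∀ y ∈ S, ∀ v, L x v = 0 → L y v = 0 → ∀ i, eval v (P i) = 0) :
    ¬ ∀ v, ∑ i, eval v (P i) ^ 2 = ∏ y, L y v := by
  classical
  intro h
  obtain ⟨y, hy, z, hz, hyz⟩ := Finset.one_lt_card.mp (by omega : 1 < S.card)
  have hxy : x ≠ y := fun e => hx (e ▸ hy)
  have hxz : x ≠ z := fun e => hx (e ▸ hz)
  obtain ⟨e, he0, hex, hey⟩ := exists_ne_zero_of_two (L x) (L y)
  obtain ⟨a, ha0, hax, haz⟩ := exists_ne_zero_of_two (L x) (L z)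
  obtain ⟨c, hc0, hcy, hcz⟩ := exists_ne_zero_of_two (L y) (L z)
  have hcx : L x c ≠ 0 := fun h0 => hc0 (hgen x y z hxy hxz hyz c h0 hcy hcz)
  have hew : ∀ w, w ≠ x → w ≠ y → L w e ≠ 0 := fun w h1 h2 h0 =>
    he0 (hgen x y w hxy h1.symm h2.symm e hex hey h0)
  have hay : L y a ≠ 0 := fun h0 => ha0 (hgen x y z hxy hxz hyz a hax h0 haz)
  obtain ⟨s, hs⟩ := exists_forall_add_mul_ne_zero (Finset.univ.erase x)
    (fun w => L w e) (fun w => L w a) (by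
      intro w hw
      by_cases hwy : w = y
      · exact Or.inr (hwy ▸ hay)
      · exact Or.inl (hew w (Finset.ne_of_mem_erase hw) hwy))
  set b := e + s • a with hb
  have hbx : L x b = 0 := by simp [hb, hex, hax]
  have hbw : ∀ w, w ≠ x → L w b ≠ 0 := by
    intro w hw
    simpa [hb] using hs w (Finset.mem_erase.mpr ⟨hw, Finset.mem_univ w⟩)
  have hline : ∀ t : ℂ, a + t • b ≠ 0 := by
    intro t h0
    have h1 : L z (a + t • b) = 0 := by rw [h0, map_zero]
    have ht : t = 0 := by simpa [haz, hbw z hxz.symm] using h1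
    exact ha0 (by simpa [ht] using h0)
  have hzero : ∀ i (t : ℂ), eval (a + t • b) (P i) = 0 := by
    intro i t
    rw [← eval_aeval_line, Polynomial.eq_zero_of_natDegree_lt_card_of_eval_eq_zero (aeval _ (P i))
      (ι := S) (f := fun w => -(L w a) / L w b), Polynomial.eval_zero]
    · rintro ⟨w, hw⟩ ⟨w', hw'⟩ hww
      have hwx : x ≠ w := fun e => hx (e ▸ hw)
      have hwx' : x ≠ w' := fun e => hx (e ▸ hw')
      by_contra hne
      refine hline (-(L w a) / L w b) (hgen x w w' hwx hwx' (fun e => hne (Subtype.ext e)) _ ?_ ?_ ?_)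
      · simp [hax, hbx]
      · simp [hbw w hwx.symm]
      · have : -(L w a) / L w b = -(L w' a) / L w' b := hww
        rw [this]
        simp [hbw w' hwx'.symm]
    · rintro ⟨w, hw⟩
      have hwx : w ≠ x := fun e => hx (e ▸ hw)
      rw [eval_aeval_line]
      refine hS w hw _ ?_ ?_ i
      · simp [hax, hbx]
      · simp [hbw w hwx]
    · refine lt_of_le_of_lt (aeval_natDegree_le (n := 1) _ (hP i) _ fun j => ?_) (by simpa using hcard)
      compute_degree
  obtain ⟨t, ht⟩ := exists_forall_add_mul_ne_zero (Finset.univ.erase x)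
    (fun w => L w a) (fun w => L w b) fun w hw => Or.inr (hbw w (Finset.ne_of_mem_erase hw))
  set u := a + t • b with hu
  set q : Fin r → Polynomial ℂ := fun i =>
    aeval (fun j => Polynomial.C (u j) + Polynomial.C (c j) * Polynomial.X) (P i) with hq
  have hq0 : ∀ i, (q i).eval 0 = 0 := fun i => by
    rw [hq, eval_aeval_line, zero_smul, add_zero]; exact hzero i t
  have hfac : ∑ i, q i ^ 2 = Polynomial.C (L x c) * Polynomial.X *
      ∏ w ∈ Finset.univ.erase x, (Polynomial.C (L w u) + Polynomial.C (L w c) * Polynomial.X) := by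
    refine Polynomial.funext fun s => ?_
    have h1 := h (u + s • c)
    rw [← Finset.mul_prod_erase _ _ (Finset.mem_univ x)] at h1
    have hux : L x u = 0 := by simp [hu, hax, hbx]
    simp only [Polynomial.eval_finsetSum, Polynomial.eval_pow, hq, eval_aeval_line, h1,
      Polynomial.eval_mul, Polynomial.eval_prod, Polynomial.eval_add, Polynomial.eval_C,
      Polynomial.eval_X, map_add, map_smul, hux, smul_eq_mul, zero_add]
    simp only [mul_comm s]
  have hder := congrArg (fun f => (Polynomial.derivative f).eval 0) hfac
  simp only [Polynomial.derivative_sum, Polynomial.derivative_sq, Polynomial.eval_finsetSum,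
    Polynomial.eval_mul, hq0, mul_zero, zero_mul, Finset.sum_const_zero, Polynomial.derivative_mul,
    Polynomial.derivative_X, Polynomial.derivative_C, Polynomial.eval_add, Polynomial.eval_prod,
    Polynomial.eval_C, Polynomial.eval_X, add_zero, zero_add, mul_one] at hder
  refine mul_ne_zero hcx (Finset.prod_ne_zero_iff.mpr fun w hw => ?_) hder.symm
  simpa [hu] using ht w hw

/-- Let `K ⊂ ℂ` be a totally imaginary number field of degree `2d ≥ 4`. The Galois
group `G = Gal(K^gal/ℚ)` acts on the set `X = Hom(K,ℂ)` of embeddings; this action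
is encoded here by post-composition with ring automorphisms of `ℂ` (every
automorphism of `ℂ` restricts to an automorphism of the Galois closure `K^gal`,
and conversely every element of `Gal(K^gal/ℚ)` extends to an automorphism of `ℂ`,
so both induce the same permutations of `X`). Complex conjugation `τ` acts by
`σ ↦ conj ∘ σ`, and `g τ g⁻¹` acts by `x ↦ g ∘ conj ∘ g⁻¹ ∘ x`. If condition
`(**)` holds — the characteristic number `c(G,X,τ) = |{g τ g⁻¹ • x : g ∈ G}|`
exceeds `d` — then for every linear form `l ∈ K[x₁,x₂,x₃]` with sufficiently
general coefficients, the norm form `f = N_{K/ℚ}(l) = ∏_{σ ∈ X} σ(l)` is not a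
sum of squares of polynomials with rational coefficients. -/
theorem statement1 (d : ℕ) (hd : 2 ≤ d) (K : IntermediateField ℚ ℂ)
    (hdeg : Module.finrank ℚ K = 2 * d)
    (himag : IsEmpty (K →+* ℝ))
    (hstarstar : ∀ x : K →+* ℂ,
      d < Nat.card {σ : K →+* ℂ | ∃ g : ℂ ≃+* ℂ,
        σ = (g : ℂ →+* ℂ).comp ((starRingEnd ℂ).comp (((g.symm : ℂ →+* ℂ)).comp x))})
    (l : MvPolynomial (Fin 3) K) (hl : l.IsHomogeneous 1)
    (hgen : ∀ σ₁ σ₂ σ₃ : K →+* ℂ, σ₁ ≠ σ₂ → σ₁ ≠ σ₃ → σ₂ ≠ σ₃ →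
      ∀ v : Fin 3 → ℂ, v ≠ 0 →
        ¬ (eval v (map σ₁ l) = 0 ∧ eval v (map σ₂ l) = 0 ∧ eval v (map σ₃ l) = 0))
    (f : MvPolynomial (Fin 3) ℚ)
    (hf : map (algebraMap ℚ ℂ) f = ∏ᶠ σ : K →+* ℂ, map σ l) :
    ¬ ∃ (r : ℕ) (p : Fin r → MvPolynomial (Fin 3) ℚ), f = ∑ i, p i ^ 2 := by
  rintro ⟨r, p, rfl⟩
  have : FiniteDimensional ℚ K := Module.finite_of_finrank_pos (by omega)
  have : NumberField K := ⟨⟩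
  rw [finprod_eq_prod_of_fintype] at hf
  have hmap : ∀ σ : K →+* ℂ, (map σ l).IsHomogeneous 1 := fun σ => hl.map σ
  choose L hL using fun σ : K →+* ℂ => exists_linearMap_eq_eval (hmap σ)
  have hdegree : (∑ i, p i ^ 2).totalDegree ≤ 2 * d := by
    have h1 : (map (algebraMap ℚ ℂ) (∑ i, p i ^ 2)).IsHomogeneous (2 * d) := by
      rw [hf]
      have := IsHomogeneous.prod Finset.univ (fun σ : K →+* ℂ => map σ l) (fun _ => 1)
        fun σ _ => hmap σ
      simpa [NumberField.Embeddings.card, hdeg] using this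
    exact (IsHomogeneous.of_map (algebraMap ℚ ℂ).injective h1).totalDegree_le
  have heval : ∀ v, ∑ i, eval v (map (algebraMap ℚ ℂ) (p i)) ^ 2 = ∏ σ, L σ v := by
    intro v
    simpa [eval_prod, hL] using congrArg (eval v) hf
  have hreal : ∀ (v : Fin 3 → ℝ) (σ : K →+* ℂ), L σ (fun j => (v j : ℂ)) = 0 →
      ∀ i, eval (fun j => (v j : ℂ)) (map (algebraMap ℚ ℂ) (p i)) = 0 := by
    intro v σ hσ i
    have hcast : ∀ i, eval (fun j => (v j : ℂ)) (map (algebraMap ℚ ℂ) (p i)) =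
        ((eval v (map (algebraMap ℚ ℝ) (p i)) : ℝ) : ℂ) := fun i =>
      (map_eval_map Complex.ofRealHom (algebraMap ℚ ℝ) v (p i)).symm
    have h1 := heval fun j => (v j : ℂ)
    rw [Finset.prod_eq_zero (Finset.mem_univ σ) hσ] at h1
    simp only [hcast] at h1 ⊢
    norm_cast at h1 ⊢
    exact pow_eq_zero_iff two_ne_zero |>.mp
      ((Finset.sum_eq_zero_iff_of_nonneg fun i _ => sq_nonneg _).mp h1 i (Finset.mem_univ i))
  have hconj : ∀ (v : Fin 3 → ℂ) (σ : K →+* ℂ), L σ v = 0 → L ((starRingEnd ℂ).comp σ) v = 0 →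
      ∀ i, eval v (map (algebraMap ℚ ℂ) (p i)) = 0 := by
    intro v σ h1 h2 i
    have h3 : L σ (starRingEnd ℂ ∘ v) = 0 := by
      have := map_eval_map (starRingEnd ℂ) ((starRingEnd ℂ).comp σ) v l
      rw [← hL, h2, map_zero] at this
      rw [hL, this, show (starRingEnd ℂ).comp ((starRingEnd ℂ).comp σ) = σ by ext; simp]
    have hv : v = (fun j => ((v j).re : ℂ)) + Complex.I • fun j => ((v j).im : ℂ) := by
      ext j
      simp [mul_comm Complex.I, Complex.re_add_im]
    have hre : (fun j => ((v j).re : ℂ)) = (1 / 2 : ℂ) • (v + starRingEnd ℂ ∘ v) := by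
      ext j
      simp [Complex.add_conj]
    have him : (fun j => ((v j).im : ℂ)) = (1 / (2 * Complex.I)) • (v - starRingEnd ℂ ∘ v) := by
      ext j
      simp [Complex.sub_conj]
      field_simp
      simp
    rw [hv]
    refine eval_line_eq_zero_of_real (fun t => ?_) _
    have h4 := hreal (fun j => (v j).re + t * (v j).im) σ
    have h5 : (fun j => (((v j).re + t * (v j).im : ℝ) : ℂ)) =
        (fun j => ((v j).re : ℂ)) + (t : ℂ) • fun j => ((v j).im : ℂ) := by
      ext j; simp
    rw [h5] at h4
    refine h4 ?_ i
    rw [map_add, map_smul, hre, him]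
    simp [h1, h3]
  obtain ⟨x⟩ : Nonempty (K →+* ℂ) := ⟨K.val.toRingHom⟩
  classical
  set S : Set (K →+* ℂ) := {σ | ∃ g : ℂ ≃+* ℂ,
    σ = (g : ℂ →+* ℂ).comp ((starRingEnd ℂ).comp (((g.symm : ℂ →+* ℂ)).comp x))}
  have hpull : ∀ y (g : ℂ ≃+* ℂ),
      y = (g : ℂ →+* ℂ).comp ((starRingEnd ℂ).comp (((g.symm : ℂ →+* ℂ)).comp x)) →
      (g.symm : ℂ →+* ℂ).comp y = (starRingEnd ℂ).comp ((g.symm : ℂ →+* ℂ).comp x) := by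
    rintro y g rfl
    ext; simp
  refine sum_sq_ne_prod hd L ?_ x S.toFinset ?_ ?_ (fun i => map (algebraMap ℚ ℂ) (p i)) ?_ ?_ heval
  · intro σ₁ σ₂ σ₃ h12 h13 h23 v h1 h2 h3
    by_contra hv
    exact hgen σ₁ σ₂ σ₃ h12 h13 h23 v hv ⟨hL σ₁ v ▸ h1, hL σ₂ v ▸ h2, hL σ₃ v ▸ h3⟩
  · rw [Set.mem_toFinset]
    rintro ⟨g, hg⟩
    have hfix := hpull x g hg
    exact himag.false (NumberField.ComplexEmbedding.IsReal.embedding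
      (NumberField.ComplexEmbedding.isReal_iff.mpr hfix.symm))
  · rw [← Nat.card_eq_card_toFinset]
    exact hstarstar x
  · exact fun i => (Finset.sup_mono (support_map_subset _ _)).trans (totalDegree_le_of_sum_sq p hdegree i)
  · intro y hy v hxv hyv i
    obtain ⟨g, hg⟩ := Set.mem_toFinset.mp hy
    have hsymm : ∀ σ : K →+* ℂ, L σ v = 0 →
        L ((g.symm : ℂ →+* ℂ).comp σ) ((g.symm : ℂ →+* ℂ) ∘ v) = 0 := by
      intro σ h0
      rw [hL, ← map_eval_map, ← hL, h0, map_zero]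
    have h1 := hsymm y hyv
    rw [hpull y g hg] at h1
    have h2 := hconj _ _ (hsymm x hxv) h1 i
    rw [Subsingleton.elim (algebraMap ℚ ℂ) ((g.symm : ℂ →+* ℂ).comp (algebraMap ℚ ℂ)),
      ← map_eval_map] at h2
    exact (map_eq_zero _).mp h2
end
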